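/- arXiv:1910.04452 — 2 statements merged into one kernel-verified Lean document; each statement's English description precedes it below -/
import Mathlib

section
/- For every finitely supported vector y ∈ X, there exists k_0 such that for every k ≥ k_0, ‖T̃^k y‖ ≤ 2^{−(η^{(0)}/(3Δ^{(0)})) k}. -/
open scoped Classical

noncomputable section

/-- `X = ℓ¹(ℕ)`. -/
abbrev X : Type := lp (fun _ : ℕ => ℂ) 1

/-- The canonical basis `(e_k)` of `ℓ¹(ℕ)`. -/
noncomputable def e (k : ℕ) : X := lp.single 1 k 1

/-- The orbit of `y` under `T` decays at least geometrically with ratio `ρ`. -/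
def HasGeometricDecay {E : Type*} [NormedAddCommGroup E] [NormedSpace ℂ E]
    (T : E →L[ℂ] E) (ρ : ℝ) (y : E) : Prop :=
  ∃ C : ℝ, ∀ k : ℕ, ‖(T ^ k) y‖ ≤ C * ρ ^ k

namespace HasGeometricDecay

variable {E : Type*} [NormedAddCommGroup E] [NormedSpace ℂ E] {T : E →L[ℂ] E} {ρ : ℝ}

theorem zero : HasGeometricDecay T ρ (0 : E) :=
  ⟨0, fun k => by simp⟩

theorem add {x y : E} (hx : HasGeometricDecay T ρ x) (hy : HasGeometricDecay T ρ y) :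
    HasGeometricDecay T ρ (x + y) := by
  obtain ⟨C, hC⟩ := hx
  obtain ⟨D, hD⟩ := hy
  refine ⟨C + D, fun k => ?_⟩
  rw [map_add, add_mul]
  exact (norm_add_le _ _).trans (add_le_add (hC k) (hD k))

theorem smul {x : E} (c : ℂ) (hx : HasGeometricDecay T ρ x) :
    HasGeometricDecay T ρ (c • x) := by
  obtain ⟨C, hC⟩ := hx
  refine ⟨‖c‖ * C, fun k => ?_⟩
  rw [map_smul, norm_smul, mul_assoc]
  exact mul_le_mul_of_nonneg_left (hC k) (norm_nonneg c)

theorem sum {ι : Type*} {s : Finset ι} {f : ι → E}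
    (hf : ∀ i ∈ s, HasGeometricDecay T ρ (f i)) : HasGeometricDecay T ρ (∑ i ∈ s, f i) :=
  Finset.sum_induction f (HasGeometricDecay T ρ) (fun _ _ => add) zero hf

theorem pow_apply {x : E} (j : ℕ) (hx : HasGeometricDecay T ρ x) :
    HasGeometricDecay T ρ ((T ^ j) x) := by
  obtain ⟨C, hC⟩ := hx
  refine ⟨C * ρ ^ j, fun k => ?_⟩
  have h := hC (k + j)
  rw [pow_add, mul_apply_eq_comp, pow_add] at h
  linarith

/-- If `T ^ D` acts on `y` as multiplication by `c`, up to a vector with geometrically decaying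
orbit, and `‖c‖ < ρ ^ D`, then the orbit of `y` decays geometrically as well. -/
theorem of_pow_apply_eq {y z : E} {D : ℕ} {c : ℂ} (hρ : 0 < ρ) (hD : 0 < D)
    (hc : ‖c‖ < ρ ^ D) (hz : HasGeometricDecay T ρ z) (h : (T ^ D) y = z + c • y) :
    HasGeometricDecay T ρ y := by
  obtain ⟨C, hC⟩ := hz
  have hgap : 0 < ρ ^ D - ‖c‖ := sub_pos.mpr hc
  obtain ⟨M, hM⟩ : ∃ M, ∀ k ∈ Finset.range D, ‖(T ^ k) y‖ / ρ ^ k ≤ M := by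
    obtain ⟨M, hM⟩ := ((Finset.range D).image fun k => ‖(T ^ k) y‖ / ρ ^ k).bddAbove
    exact ⟨M, fun k hk => hM (by simpa using ⟨k, by simpa using hk, rfl⟩)⟩
  refine ⟨max M (C / (ρ ^ D - ‖c‖)), fun k => ?_⟩
  induction k using Nat.strong_induction_on with
  | _ k ih =>
    rcases lt_or_ge k D with hk | hk
    · rw [← div_le_iff₀ (pow_pos hρ k)]
      exact (hM k (Finset.mem_range.mpr hk)).trans (le_max_left _ _)
    · obtain ⟨j, rfl⟩ := Nat.exists_eq_add_of_le' hk
      have hj := ih j (by lia)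
      set K := max M (C / (ρ ^ D - ‖c‖)) with hK
      have hCK : C ≤ K * (ρ ^ D - ‖c‖) := by
        rw [← div_le_iff₀ hgap]
        exact le_max_right _ _
      rw [pow_add, mul_apply_eq_comp, h, map_add, map_smul]
      calc ‖(T ^ j) z + c • (T ^ j) y‖ ≤ C * ρ ^ j + ‖c‖ * (K * ρ ^ j) := by
            refine (norm_add_le _ _).trans (add_le_add (hC j) ?_)
            rw [norm_smul]
            exact mul_le_mul_of_nonneg_left hj (norm_nonneg c)
        _ = (C + K * ‖c‖) * ρ ^ j := by ring
        _ ≤ (K * ρ ^ D) * ρ ^ j :=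
            mul_le_mul_of_nonneg_right (by linarith) (pow_pos hρ j).le
        _ = K * ρ ^ (j + D) := by ring

/-- A geometric decay rate beats any strictly larger ratio eventually, with constant one. -/
theorem eventually_norm_le {y : E} {σ : ℝ} (hρ : 0 < ρ) (hσ : ρ < σ)
    (hy : HasGeometricDecay T ρ y) : ∃ k₀ : ℕ, ∀ k, k₀ ≤ k → ‖(T ^ k) y‖ ≤ σ ^ k := by
  obtain ⟨C, hC⟩ := hy
  have hσ0 : 0 < σ := hρ.trans hσ
  have hlim : Filter.Tendsto (fun k : ℕ => C * (ρ / σ) ^ k) Filter.atTop (nhds 0) := by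
    simpa using (tendsto_pow_atTop_nhds_zero_of_lt_one (div_pos hρ hσ0).le
      ((div_lt_one hσ0).mpr hσ)).const_mul C
  obtain ⟨k₀, hk₀⟩ := Filter.eventually_atTop.mp (hlim.eventually (eventually_le_nhds one_pos))
  refine ⟨k₀, fun k hk => (hC k).trans ?_⟩
  have h := hk₀ k hk
  rw [div_pow, ← mul_div_assoc, div_le_one (pow_pos hσ0 k)] at h
  exact h

end HasGeometricDecay

/-- A sequence starting at `0` and exceeding `n` has a consecutive pair of terms around `n`. -/
theorem exists_le_and_lt_succ {f : ℕ → ℕ} {n : ℕ} (h0 : f 0 = 0) (hf : ∃ k, n < f (k + 1)) :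
    ∃ k, f k ≤ n ∧ n < f (k + 1) := by
  refine ⟨Nat.find hf, ?_, Nat.find_spec hf⟩
  rcases hk : Nat.find hf with _ | m
  · simp [h0]
  · exact not_lt.mp (Nat.find_min hf (by lia))

/-- A finitely supported vector of `ℓ¹(ℕ)` is a finite combination of basis vectors. -/
theorem eq_sum_smul_e_of_finite_support (y : X) (hy : {i : ℕ | y i ≠ 0}.Finite) :
    y = ∑ i ∈ hy.toFinset, y i • e i := by
  ext j
  rw [lp.coeFn_sum, Finset.sum_apply]
  simp only [lp.coeFn_smul, Pi.smul_apply, e, lp.single_apply, Pi.single_apply, smul_eq_mul,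
    mul_ite, mul_one, mul_zero, Finset.sum_ite_eq, Set.Finite.mem_toFinset, Set.mem_ofPred_eq]
  grind

/-- A weighted forward shift moves the basis vector `e a` along a block. -/
theorem pow_apply_e_of_shift {T : X →L[ℂ] X} {w : ℕ → ℂ} {a c : ℕ}
    (hT : ∀ k, a ≤ k → k + 1 < c → T (e k) = w (k + 1) • e (k + 1)) (j : ℕ) (hj : a + j < c) :
    (T ^ j) (e a) = (∏ i ∈ Finset.range j, w (a + i + 1)) • e (a + j) := by
  induction j with
  | zero => simp
  | succ j ih =>
    rw [pow_succ', mul_apply_eq_comp, ih (by lia), map_smul,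
      hT (a + j) (by lia) (by lia), smul_smul, Finset.prod_range_succ]
    rfl

/-- The product of the weights over one block is `2 ^ (-h)`: the trailing stretches of `1 / 2`
and `2` cancel. -/
theorem prod_block_weights {w : ℕ → ℂ} {a d h D : ℕ} (hD : 2 * d + h < D)
    (hw : ∀ i, a < i → i < a + D →
      w i = if i ≤ a + h then (1 / 2 : ℂ)
        else if i < a + D - 2 * d then 1
        else if i < a + D - d then (1 / 2 : ℂ)
        else 2) :
    ∏ i ∈ Finset.range (D - 1), w (a + i + 1) = (1 / 2 : ℂ) ^ h := by
  obtain ⟨m, hm⟩ : ∃ m, D - 1 = h + m + d + d := ⟨D - 1 - h - 2 * d, by lia⟩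
  rw [hm, Finset.prod_range_add, Finset.prod_range_add, Finset.prod_range_add]
  have h₁ : ∏ i ∈ Finset.range h, w (a + i + 1) = (1 / 2 : ℂ) ^ h := by
    refine (Finset.prod_eq_pow_card fun i hi => ?_).trans (by rw [Finset.card_range])
    rw [Finset.mem_range] at hi
    rw [hw _ (by lia) (by lia), if_pos (by lia)]
  have h₂ : ∏ i ∈ Finset.range m, w (a + (h + i) + 1) = 1 := by
    refine Finset.prod_eq_one fun i hi => ?_
    rw [Finset.mem_range] at hi
    rw [hw _ (by lia) (by lia), if_neg (by lia), if_pos (by lia)]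
  have h₃ : ∏ i ∈ Finset.range d, w (a + (h + m + i) + 1) = (1 / 2 : ℂ) ^ d := by
    refine (Finset.prod_eq_pow_card fun i hi => ?_).trans (by rw [Finset.card_range])
    rw [Finset.mem_range] at hi
    rw [hw _ (by lia) (by lia), if_neg (by lia), if_neg (by lia), if_pos (by lia)]
  have h₄ : ∏ i ∈ Finset.range d, w (a + (h + m + d + i) + 1) = (2 : ℂ) ^ d := by
    refine (Finset.prod_eq_pow_card fun i hi => ?_).trans (by rw [Finset.card_range])
    rw [Finset.mem_range] at hi
    rw [hw _ (by lia) (by lia), if_neg (by lia), if_neg (by lia), if_neg (by lia)]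
  rw [h₁, h₂, h₃, h₄, mul_one, mul_assoc, ← mul_pow]
  norm_num

/-- All basis vectors of a block decay geometrically when its first one does. -/
theorem hasGeometricDecay_e_of_shift {T : X →L[ℂ] X} {w : ℕ → ℂ} {a c : ℕ} {ρ : ℝ}
    (hT : ∀ k, a ≤ k → k + 1 < c → T (e k) = w (k + 1) • e (k + 1))
    (hw : ∀ i, a < i → i < c → w i ≠ 0) (ha : HasGeometricDecay T ρ (e a))
    (i : ℕ) (hai : a ≤ i) (hic : i < c) : HasGeometricDecay T ρ (e i) := by
  obtain ⟨j, rfl⟩ := Nat.exists_eq_add_of_le hai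
  have hne : ∏ i ∈ Finset.range j, w (a + i + 1) ≠ 0 :=
    Finset.prod_ne_zero_iff.mpr fun i hi => by
      rw [Finset.mem_range] at hi
      exact hw _ (by lia) (by lia)
  have h := (ha.pow_apply j).smul (∏ i ∈ Finset.range j, w (a + i + 1))⁻¹
  rwa [pow_apply_e_of_shift hT j hic, smul_smul, inv_mul_cancel₀ hne, one_smul] at h

/-- Lemma 3.2 (1): for every finitely supported `y ∈ ℓ¹(ℕ)` there is `k₀` such that
`‖T̃^k y‖ ≤ 2^{-(η⁽⁰⁾/(3Δ⁽⁰⁾)) k}` for every `k ≥ k₀`. -/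
theorem decay_of_finitely_supported
    -- the parameters `(τ_m)`, `(δ^{(k)})`, `(η^{(k)})`, `(Δ^{(k)})`:
    -- increasing sequences of positive integers
    (τ δ η Δ : ℕ → ℕ)
    (hτ : StrictMono τ) (hτpos : ∀ m, 0 < τ m)
    (hδ : StrictMono δ) (hδpos : ∀ k, 0 < δ k)
    (hη : StrictMono η) (hηpos : ∀ k, 0 < η k)
    (hΔ : StrictMono Δ) (hΔpos : ∀ k, 0 < Δ k)
    (hcomb : ∀ k, 2 * δ k + η k < Δ k)
    (hdvd : ∀ k, 2 * Δ k ∣ Δ (k + 1))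
    (hratio : ∀ k, (η k : ℝ) / (Δ k : ℝ) = (η 0 : ℝ) / (Δ 0 : ℝ))
    -- `n_0 = 0` and `n_k = 2^{k-1}` for `k ≥ 1`
    (nseq : ℕ → ℕ) (hn0 : nseq 0 = 0) (hnk : ∀ k, 1 ≤ k → nseq k = 2 ^ (k - 1))
    -- `φ(n) = n - n_k` for `n ∈ [n_k, n_{k+1})`
    (φ : ℕ → ℕ) (hφ : ∀ k n, nseq k ≤ n → n < nseq (k + 1) → φ n = n - nseq k)
    -- `v_n = 2^{-τ_{φ(n)}}` for `n ≥ 1`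
    (v : ℕ → ℂ) (hv : ∀ n, 1 ≤ n → v n = (2 : ℂ) ^ (-(τ (φ n) : ℤ)))
    -- `b_0 = 0` and `b_{n+1} - b_n = Δ^{(k)}` for `n ∈ [n_k, n_{k+1})`
    (b : ℕ → ℕ) (hb0 : b 0 = 0)
    (hb : ∀ k n, nseq k ≤ n → n < nseq (k + 1) → b (n + 1) = b n + Δ k)
    -- the weights `(w_i)`
    (w : ℕ → ℂ)
    (hw : ∀ k n, nseq k ≤ n → n < nseq (k + 1) → ∀ i, b n < i → i < b (n + 1) →
      w i = if i ≤ b n + η k then (1 / 2 : ℂ)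
        else if i < b (n + 1) - 2 * δ k then 1
        else if i < b (n + 1) - δ k then (1 / 2 : ℂ)
        else 2)
    -- the defining equations of the operator `T̃`
    (T : X →L[ℂ] X)
    (hT1 : ∀ n k, b n ≤ k → k + 1 < b (n + 1) → T (e k) = w (k + 1) • e (k + 1))
    (hT2 : ∀ n, 1 ≤ n → T (e (b (n + 1) - 1)) = v n • e (b (φ n)) - e (b n))
    (hT3 : T (e (b 1 - 1)) = -(e 0))
    : ∀ y : X, {i : ℕ | y i ≠ 0}.Finite →
      ∃ k₀ : ℕ, ∀ k, k₀ ≤ k →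
        ‖(T ^ k) y‖ ≤ (2 : ℝ) ^ (-((η 0 : ℝ) / (3 * (Δ 0 : ℝ))) * (k : ℝ)) := by
  have hlt_nseq : ∀ k, k < nseq (k + 1) := fun k => by
    rw [hnk (k + 1) (by lia)]
    simpa using Nat.lt_two_pow_self
  have hlevel : ∀ n, ∃ k, nseq k ≤ n ∧ n < nseq (k + 1) := fun n =>
    exists_le_and_lt_succ hn0 ⟨n, hlt_nseq n⟩
  have hφ_lt : ∀ n, 1 ≤ n → φ n < n := fun n hn => by
    obtain ⟨k, hk, hk'⟩ := hlevel n
    have hk1 : 1 ≤ k := by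
      rcases Nat.eq_zero_or_pos k with rfl | h
      · rw [hnk (0 + 1) le_rfl] at hk'
        simp at hk'
        lia
      · exact h
    have : 0 < nseq k := by rw [hnk k hk1]; positivity
    rw [hφ k n hk hk']
    lia
  have hb_mono : StrictMono b := strictMono_nat_of_lt_succ fun n => by
    obtain ⟨k, hk, hk'⟩ := hlevel n
    rw [hb k n hk hk']
    exact Nat.lt_add_of_pos_right (hΔpos k)
  have hblock : ∀ i, ∃ n, b n ≤ i ∧ i < b (n + 1) := fun i =>
    exists_le_and_lt_succ hb0 ⟨i, (Nat.lt_succ_self i).trans_le (hb_mono.id_le (i + 1))⟩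
  set r : ℝ := (η 0 : ℝ) / (Δ 0 : ℝ) with hr
  have hr0 : 0 < r := div_pos (by exact_mod_cast hηpos 0) (by exact_mod_cast hΔpos 0)
  set ρ : ℝ := (2 : ℝ) ^ (-(r / 2)) with hρ_def
  have hρ : 0 < ρ := Real.rpow_pos_of_pos two_pos _
  have hrate : ∀ k, ‖(-(1 / 2 : ℂ) ^ η k)‖ < ρ ^ Δ k := fun k => by
    have hΔk : (0 : ℝ) < Δ k := by exact_mod_cast hΔpos k
    have hηk : (η k : ℝ) = r * Δ k := by rw [← hratio k, div_mul_cancel₀ _ hΔk.ne']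
    have hnorm : ‖(-(1 / 2 : ℂ) ^ η k)‖ = (2 : ℝ) ^ (-(η k : ℝ)) := by
      rw [Real.rpow_neg two_pos.le, Real.rpow_natCast]
      simp
    rw [hnorm, hρ_def, ← Real.rpow_natCast, ← Real.rpow_mul two_pos.le, hηk]
    refine Real.rpow_lt_rpow_of_exponent_lt one_lt_two ?_
    nlinarith [mul_pos hr0 hΔk]
  have hfirst : ∀ n, HasGeometricDecay T ρ (e (b n)) := by
    intro n
    induction n using Nat.strong_induction_on with
    | _ n ih =>
      obtain ⟨k, hk, hk'⟩ := hlevel n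
      have hbn := hb k n hk hk'
      have hΔk := hΔpos k
      have hcycle : (T ^ Δ k) (e (b n)) = (1 / 2 : ℂ) ^ η k • T (e (b (n + 1) - 1)) := by
        have hprod := prod_block_weights (w := w) (hcomb k) (hbn ▸ hw k n hk hk')
        have hend : b n + (Δ k - 1) = b (n + 1) - 1 := by lia
        have hpow := pow_apply_e_of_shift (hT1 n) (Δ k - 1) (by lia)
        rw [hprod, hend] at hpow
        rw [← Nat.sub_add_cancel hΔk, pow_succ', mul_apply_eq_comp, hpow, map_smul]
      rcases Nat.eq_zero_or_pos n with rfl | hn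
      · refine HasGeometricDecay.of_pow_apply_eq hρ hΔk (hrate k) HasGeometricDecay.zero ?_
        rw [hcycle, hT3, hb0, smul_neg, neg_smul, zero_add]
      · refine HasGeometricDecay.of_pow_apply_eq hρ hΔk (hrate k)
          ((ih _ (hφ_lt n hn)).smul ((1 / 2 : ℂ) ^ η k * v n)) ?_
        rw [hcycle, hT2 n hn, smul_sub, smul_smul, neg_smul, sub_eq_add_neg]
  have hbasis : ∀ i, HasGeometricDecay T ρ (e i) := fun i => by
    obtain ⟨n, hn, hn'⟩ := hblock i
    obtain ⟨k, hk, hk'⟩ := hlevel n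
    refine hasGeometricDecay_e_of_shift (hT1 n) (fun j hj hj' => ?_) (hfirst n) i hn hn'
    rw [hw k n hk hk' j hj hj']
    split_ifs <;> norm_num
  intro y hy
  have hdecay : HasGeometricDecay T ρ y := by
    rw [eq_sum_smul_e_of_finite_support y hy]
    exact HasGeometricDecay.sum fun i _ => (hbasis i).smul (y i)
  have hσ : ρ < (2 : ℝ) ^ (-(r / 3)) :=
    Real.rpow_lt_rpow_of_exponent_lt one_lt_two (by linarith)
  obtain ⟨k₀, hk₀⟩ := hdecay.eventually_norm_le hρ hσ
  refine ⟨k₀, fun k hk => (hk₀ k hk).trans_eq ?_⟩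
  rw [← Real.rpow_natCast, ← Real.rpow_mul two_pos.le, hr, div_div, mul_comm (Δ 0 : ℝ) 3]
end
end

section
/- T̃ is a frequently hypercyclic operator on ℓ¹(ℕ); that is, there exists x ∈ X such that for every non-empty open set U ⊆ X the set {n ∈ ℕ : T̃^n x ∈ U} has positive lower density. -/
open scoped Classical

noncomputable section

/-- An operator `T` on `X` is frequently hypercyclic if there is `x ∈ X` such that for every
non-empty open set `U ⊆ X` the set `{n : T^n x ∈ U}` has positive lower density. -/
def FrequentlyHypercyclic (T : X →L[ℂ] X) : Prop :=
  ∃ x : X, ∀ U : Set X, IsOpen U → U.Nonempty →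
    0 < Filter.liminf (fun N : ℕ =>
      (((Finset.range N).filter (fun n => (T ^ n) x ∈ U)).card : ℝ) / N) Filter.atTop

section Criterion

variable {E : Type*} [NormedAddCommGroup E] [NormedSpace ℂ E]

lemma pow_add_apply (T : E →L[ℂ] E) (m n : ℕ) (x : E) :
    (T ^ (m + n)) x = (T ^ m) ((T ^ n) x) := by
  rw [pow_add]; rfl

/-- Up to `ε`, the vector `y` is reached at every large time `n` by some orbit which decays
geometrically, at rate `ρ` and uniformly in `n`, away from the time `n`. -/
def IsTraceable (T : E →L[ℂ] E) (ρ : ℝ) (y : E) : Prop :=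
  ∀ ε > 0, ∃ C : ℝ, ∃ n₀ : ℕ, ∀ n ≥ n₀, ∃ x : E,
    (∀ i, ‖(T ^ i) x‖ ≤ C * ρ ^ ((n - i) + (i - n))) ∧ ‖(T ^ n) x - y‖ ≤ ε

lemma IsTraceable.add {T : E →L[ℂ] E} {ρ : ℝ} {y z : E} (hy : IsTraceable T ρ y)
    (hz : IsTraceable T ρ z) : IsTraceable T ρ (y + z) := by
  intro ε hε
  obtain ⟨C, n₀, h⟩ := hy (ε / 2) (by positivity)
  obtain ⟨C', n₀', h'⟩ := hz (ε / 2) (by positivity)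
  refine ⟨C + C', max n₀ n₀', fun n hn => ?_⟩
  obtain ⟨x, hx, hxy⟩ := h n (le_trans (le_max_left _ _) hn)
  obtain ⟨x', hx', hxy'⟩ := h' n (le_trans (le_max_right _ _) hn)
  refine ⟨x + x', fun i => ?_, ?_⟩
  · rw [map_add, add_mul]
    exact norm_add_le_of_le (hx i) (hx' i)
  · rw [map_add, add_sub_add_comm, ← add_halves ε]
    exact norm_add_le_of_le hxy hxy'

lemma IsTraceable.map {T : E →L[ℂ] E} {ρ : ℝ} {y : E} (hy : IsTraceable T ρ y)
    (S : E →L[ℂ] E) (hS : Commute T S) : IsTraceable T ρ (S y) := by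
  intro ε hε
  obtain ⟨C, n₀, h⟩ := hy (ε / (‖S‖ + 1)) (by positivity)
  have hcomm : ∀ i x, (T ^ i) (S x) = S ((T ^ i) x) := fun i x =>
    congrArg (fun R : E →L[ℂ] E => R x) (hS.pow_left i).eq
  refine ⟨‖S‖ * C, n₀, fun n hn => ?_⟩
  obtain ⟨x, hx, hxy⟩ := h n hn
  refine ⟨S x, fun i => ?_, ?_⟩
  · rw [hcomm, mul_assoc]
    exact (S.le_opNorm _).trans (by gcongr; exact hx i)
  · rw [hcomm, ← map_sub]
    calc ‖S ((T ^ n) x - y)‖ ≤ ‖S‖ * ‖(T ^ n) x - y‖ := S.le_opNorm _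
      _ ≤ (‖S‖ + 1) * (ε / (‖S‖ + 1)) := by gcongr; linarith
      _ = ε := by field_simp

lemma IsTraceable.smul {T : E →L[ℂ] E} {ρ : ℝ} {y : E} (hy : IsTraceable T ρ y) (c : ℂ) :
    IsTraceable T ρ (c • y) :=
  hy.map (c • 1) ((Commute.one_right T).smul_right c)

lemma IsTraceable.of_mem_closure {T : E →L[ℂ] E} {ρ : ℝ} {y : E} {s : Set E}
    (hs : ∀ z ∈ s, IsTraceable T ρ z) (hy : y ∈ closure s) : IsTraceable T ρ y := by
  intro ε hε
  obtain ⟨z, hz, hyz⟩ := Metric.mem_closure_iff.1 hy (ε / 2) (by positivity)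
  obtain ⟨C, n₀, h⟩ := hs z hz (ε / 2) (by positivity)
  refine ⟨C, n₀, fun n hn => ?_⟩
  obtain ⟨x, hx, hxz⟩ := h n hn
  refine ⟨x, hx, ?_⟩
  rw [dist_comm, dist_eq_norm] at hyz
  calc ‖(T ^ n) x - y‖ = ‖((T ^ n) x - z) + (z - y)‖ := by congr 1; abel
    _ ≤ ε / 2 + ε / 2 := norm_add_le_of_le hxz hyz.le
    _ = ε := by ring

lemma IsTraceable.of_mem_closure_span {T : E →L[ℂ] E} {ρ : ℝ} {y : E} {s : Set E}
    (hs : ∀ z ∈ s, IsTraceable T ρ z) (hy : y ∈ closure (Submodule.span ℂ s : Set E)) :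
    IsTraceable T ρ y := by
  refine IsTraceable.of_mem_closure (fun z hz => ?_) hy
  induction hz using Submodule.span_induction with
  | mem z hz => exact hs z hz
  | zero => exact fun ε hε => ⟨0, 0, fun n _ => ⟨0, by simp, by simpa using hε.le⟩⟩
  | add y z _ _ hy hz => exact hy.add hz
  | smul c y _ hy => exact hy.smul c

/-- Spacing allotted around the `i`-th visiting time. -/
def spacing (i : ℕ) : ℕ := padicValNat 2 i + 1

/-- The `i`-th visiting time; consecutive times are separated by the sum of their spacings. -/
def visitTime (i : ℕ) : ℕ := 2 * ∑ j ∈ Finset.range i, spacing j + spacing i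

lemma visitTime_add_le {i j : ℕ} (h : i < j) :
    visitTime i + spacing i + spacing j + (j - i - 1) ≤ visitTime j := by
  induction j, h using Nat.le_induction with
  | base => simp only [visitTime, Finset.sum_range_succ]; omega
  | succ j hj ih =>
    have : 1 ≤ spacing j := by simp [spacing]
    simp only [visitTime, Finset.sum_range_succ] at ih ⊢
    omega

lemma strictMono_visitTime : StrictMono visitTime := by
  intro i j h
  have := visitTime_add_le h
  have : 1 ≤ spacing j := by simp [spacing]
  omega

lemma add_spacing_le_visitTime (i : ℕ) : i + spacing i ≤ visitTime i := by
  have h : ∑ j ∈ Finset.range i, 1 ≤ ∑ j ∈ Finset.range i, spacing j :=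
    Finset.sum_le_sum fun j _ => by simp [spacing]
  simp only [Finset.sum_const, Finset.card_range, smul_eq_mul, mul_one] at h
  simp only [visitTime]
  omega

lemma sum_spacing (i : ℕ) :
    ∑ j ∈ Finset.range (i + 1), spacing j = padicValNat 2 i.factorial + (i + 1) := by
  induction i with
  | zero => simp [spacing]
  | succ i ih =>
    rw [Finset.sum_range_succ, ih, Nat.factorial_succ,
      padicValNat.mul (by omega) (Nat.factorial_ne_zero i), spacing]
    ring

lemma visitTime_le (i : ℕ) : visitTime i ≤ 4 * i + 2 := by
  have h := sum_spacing i
  have h' : (2 - 1) * padicValNat 2 i.factorial = i - (Nat.digits 2 i).sum :=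
    sub_one_mul_padicValNat_factorial (p := 2) i
  rw [Finset.sum_range_succ] at h
  simp only [visitTime]
  omega

lemma spacing_two_pow_mul_odd (v h : ℕ) : spacing (2 ^ v * (2 * h + 1)) = v + 1 := by
  rw [spacing, padicValNat.mul (by positivity) (by omega), padicValNat.prime_pow,
    padicValNat.eq_zero_of_not_dvd (by omega), add_zero]

lemma card_visits_ge {A : Set ℕ} {v : ℕ} (hA : ∀ i, spacing i = v + 1 → visitTime i ∈ A)
    (N : ℕ) : N / (12 * 2 ^ v) ≤ ((Finset.range N).filter (fun n => n ∈ A)).card := by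
  calc N / (12 * 2 ^ v)
      = ((Finset.range (N / (12 * 2 ^ v))).image
          (fun h => visitTime (2 ^ v * (2 * h + 1)))).card := by
        rw [Finset.card_image_of_injective, Finset.card_range]
        intro h h' hh
        have := Nat.eq_of_mul_eq_mul_left (by positivity) (strictMono_visitTime.injective hh)
        omega
    _ ≤ _ := by
        refine Finset.card_le_card fun n hn => ?_
        obtain ⟨h, hh, rfl⟩ := Finset.mem_image.1 hn
        rw [Finset.mem_range] at hh
        refine Finset.mem_filter.2 ⟨Finset.mem_range.2 ?_, hA _ (spacing_two_pow_mul_odd v h)⟩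
        have h1 := visitTime_le (2 ^ v * (2 * h + 1))
        have h2 : 12 * 2 ^ v * (h + 1) ≤ N :=
          (Nat.mul_le_mul_left _ hh).trans (Nat.mul_div_le _ _)
        have h3 : 1 ≤ 2 ^ v := Nat.one_le_two_pow
        nlinarith

lemma liminf_card_div_pos {A : Set ℕ} {M : ℕ} (hM : 0 < M)
    (hA : ∀ N, N / M ≤ ((Finset.range N).filter (fun n => n ∈ A)).card) :
    0 < Filter.liminf (fun N : ℕ =>
      (((Finset.range N).filter (fun n => n ∈ A)).card : ℝ) / N) Filter.atTop := by
  have hM' : (0 : ℝ) < M := by exact_mod_cast hM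
  refine lt_of_lt_of_le (b := 1 / (2 * M : ℝ)) (by positivity) ?_
  refine Filter.le_liminf_of_le ?_ ?_
  · refine Filter.IsBoundedUnder.isCoboundedUnder_ge ⟨1, ?_⟩
    refine Filter.eventually_map.2 (Filter.Eventually.of_forall fun N => ?_)
    refine div_le_one_of_le₀ ?_ (Nat.cast_nonneg N)
    exact_mod_cast (Finset.card_filter_le _ _).trans (Finset.card_range N).le
  · filter_upwards [Filter.eventually_ge_atTop M] with N hN
    have hN0 : (0 : ℝ) < N := by exact_mod_cast hM.trans_le hN
    rw [div_le_div_iff₀ (by positivity) hN0]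
    have h1 : 1 ≤ N / M := Nat.div_pos hN hM
    have h2 : N < M * (N / M + 1) := Nat.lt_mul_div_succ N hM
    have h3 : N ≤ (N / M) * (2 * M) := by nlinarith
    calc (1 : ℝ) * N ≤ ((N / M : ℕ) : ℝ) * (2 * M) := by rw [one_mul]; exact_mod_cast h3
      _ ≤ _ := by gcongr; exact hA N

lemma summable_pow_dist {ρ : ℝ} (h0 : 0 ≤ ρ) (h1 : ρ < 1) (i : ℕ) :
    Summable fun j : ℕ => ρ ^ ((i - j) + (j - i)) := by
  rw [← summable_nat_add_iff i]
  refine (summable_geometric_of_lt_one h0 h1).congr fun j => ?_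
  congr 1; omega

lemma tsum_pow_dist_le {ρ : ℝ} (h0 : 0 ≤ ρ) (h1 : ρ < 1) (i : ℕ) :
    ∑' j : ℕ, ρ ^ ((i - j) + (j - i)) ≤ 2 * (1 - ρ)⁻¹ := by
  have hs := summable_geometric_of_lt_one h0 h1
  rw [← (summable_pow_dist h0 h1 i).sum_add_tsum_nat_add i, two_mul]
  refine add_le_add ?_ (le_of_eq ?_)
  · rw [← Finset.sum_range_reflect, ← tsum_geometric_of_lt_one h0 h1]
    refine (Finset.sum_le_sum fun j hj => ?_).trans
      (hs.sum_le_tsum (Finset.range i) fun _ _ => by positivity)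
    exact pow_le_pow_of_le_one h0 h1.le (by rw [Finset.mem_range] at hj; omega)
  · rw [← tsum_geometric_of_lt_one h0 h1]
    refine tsum_congr fun j => ?_
    congr 1; omega

/-- A family of orbits, the `i`-th one concentrated around `visitTime i`, has a sum whose orbit
follows each of them at its visiting time. -/
lemma exists_tracing_sum [CompleteSpace E] {T : E →L[ℂ] E} {ρ : ℝ} (h0 : 0 < ρ) (h1 : ρ < 1)
    (z : ℕ → E)
    (hz : ∀ i n, ‖(T ^ n) (z i)‖ * ρ ^ padicValNat 2 i
      ≤ ρ ^ ((visitTime i - n) + (n - visitTime i))) :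
    ∃ x : E, ∀ i, ‖(T ^ visitTime i) x - (T ^ visitTime i) (z i)‖
      ≤ ρ ^ spacing i * (2 * (1 - ρ)⁻¹) := by
  have hsum : Summable z := by
    refine Summable.of_norm_bounded (summable_geometric_of_lt_one h0.le h1) fun i => ?_
    have h := hz i 0
    have h' := add_spacing_le_visitTime i
    rw [pow_zero, one_apply_eq_self] at h
    refine le_of_mul_le_mul_right (h.trans ?_) (pow_pos h0 (padicValNat 2 i))
    rw [← pow_add]
    exact pow_le_pow_of_le_one h0.le h1.le (by simp only [spacing] at h'; omega)
  refine ⟨∑' j, z j, fun i => ?_⟩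
  have hdiff : (T ^ visitTime i) (∑' j, z j) - (T ^ visitTime i) (z i)
      = ∑' j, if j = i then 0 else (T ^ visitTime i) (z j) := by
    rw [(T ^ visitTime i).map_tsum hsum,
      ((T ^ visitTime i).summable hsum).tsum_eq_add_tsum_ite i, add_sub_cancel_left]
  rw [hdiff]
  have hle : ∀ j, ‖if j = i then 0 else (T ^ visitTime i) (z j)‖
      ≤ ρ ^ spacing i * ρ ^ ((i - j) + (j - i)) := by
    intro j
    split_ifs with hji
    · rw [norm_zero]; positivity
    refine le_of_mul_le_mul_right ((hz j (visitTime i)).trans ?_)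
      (pow_pos h0 (padicValNat 2 j))
    rw [← pow_add, ← pow_add]
    refine pow_le_pow_of_le_one h0.le h1.le ?_
    rcases lt_or_gt_of_ne hji with h | h
    · have := visitTime_add_le h
      simp only [spacing] at this ⊢
      omega
    · have := visitTime_add_le h
      simp only [spacing] at this ⊢
      omega
  refine (tsum_of_norm_bounded ((summable_pow_dist h0.le h1 i).mul_left _).hasSum hle).trans ?_
  rw [tsum_mul_left]
  gcongr
  exact tsum_pow_dist_le h0.le h1 i

lemma exists_visits_every_open [CompleteSpace E] [TopologicalSpace.SeparableSpace E]
    {T : E →L[ℂ] E} {ρ : ℝ} (h0 : 0 < ρ) (h1 : ρ < 1) (hT : ∀ y, IsTraceable T ρ y) :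
    ∃ x : E, ∀ U : Set E, IsOpen U → U.Nonempty →
      ∃ v, ∀ i, spacing i = v + 1 → (T ^ visitTime i) x ∈ U := by
  let y : ℕ → E := fun p => TopologicalSpace.denseSeq E p.unpair.1
  let ε : ℕ → ℝ := fun p => 1 / ((p.unpair.2 : ℝ) + 1)
  have hε : ∀ p, 0 < ε p := fun p => by positivity
  choose C n₀ a ha hay using fun p => hT (y p) (ε p) (hε p)
  have hex : ∀ i, ∃ z : E, (∀ n, ‖(T ^ n) z‖ * ρ ^ padicValNat 2 i
      ≤ ρ ^ ((visitTime i - n) + (n - visitTime i))) ∧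
      ∀ p, (padicValNat 2 i).unpair.1 = p → C p * ρ ^ padicValNat 2 i ≤ 1 →
        n₀ p ≤ padicValNat 2 i → ‖(T ^ visitTime i) z - y p‖ ≤ ε p := by
    intro i
    set p := (padicValNat 2 i).unpair.1 with hp
    have hi := add_spacing_le_visitTime i
    simp only [spacing] at hi
    by_cases h : C p * ρ ^ padicValNat 2 i ≤ 1 ∧ n₀ p ≤ padicValNat 2 i
    · have hn : visitTime i ≥ n₀ p := by omega
      refine ⟨a p _ hn, fun n => ?_, ?_⟩
      · calc ‖(T ^ n) (a p _ hn)‖ * ρ ^ padicValNat 2 i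
            ≤ C p * ρ ^ ((visitTime i - n) + (n - visitTime i)) * ρ ^ padicValNat 2 i := by
              gcongr; exact ha p _ hn n
          _ = (C p * ρ ^ padicValNat 2 i) * ρ ^ ((visitTime i - n) + (n - visitTime i)) := by
              ring
          _ ≤ 1 * ρ ^ ((visitTime i - n) + (n - visitTime i)) := by gcongr; exact h.1
          _ = _ := one_mul _
      · rintro _ rfl _ _
        exact hay p _ hn
    · refine ⟨0, fun n => by rw [map_zero, norm_zero, zero_mul]; positivity, ?_⟩
      rintro _ rfl h2 h3
      exact absurd ⟨h2, h3⟩ h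
  choose z hz hzy using hex
  obtain ⟨x, hx⟩ := exists_tracing_sum h0 h1 z hz
  refine ⟨x, fun U hU hne => ?_⟩
  obtain ⟨j, hj⟩ := (TopologicalSpace.denseRange_denseSeq E).exists_mem_open hU hne
  obtain ⟨r, hr, hball⟩ := Metric.isOpen_iff.1 hU _ hj
  obtain ⟨m, hm⟩ := exists_nat_one_div_lt (half_pos hr)
  set p := Nat.pair j m with hp
  have hpow := tendsto_pow_atTop_nhds_zero_of_lt_one h0.le h1
  have hlim1 : Filter.Tendsto (fun v : ℕ => C p * ρ ^ v) Filter.atTop (nhds 0) := by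
    simpa using hpow.const_mul (C p)
  have hlim2 : Filter.Tendsto (fun v : ℕ => ρ ^ (v + 1) * (2 * (1 - ρ)⁻¹))
      Filter.atTop (nhds 0) := by
    simpa using ((Filter.tendsto_add_atTop_iff_nat 1).2 hpow).mul_const (2 * (1 - ρ)⁻¹)
  obtain ⟨V, hV⟩ := Filter.eventually_atTop.1 (((hlim1.eventually_lt_const one_pos).and
    (hlim2.eventually_lt_const (half_pos hr))).and (Filter.eventually_ge_atTop (n₀ p)))
  have hVle : V ≤ Nat.pair p V := Nat.right_le_pair p V
  obtain ⟨⟨hv1, hv2⟩, hv3⟩ := hV _ hVle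
  refine ⟨Nat.pair p V, fun i hi => hball ?_⟩
  have hval : padicValNat 2 i = Nat.pair p V := by simpa [spacing] using hi
  have hnear := hzy i p (by rw [hval, Nat.unpair_pair]) (by rw [hval]; exact hv1.le)
    (by rw [hval]; exact hv3)
  have hyp : y p = TopologicalSpace.denseSeq E j := by simp [y, hp]
  have hεp : ε p < r / 2 := by simpa [ε, hp] using hm
  rw [Metric.mem_ball, dist_eq_norm, ← hyp]
  have hxi := hx i
  rw [hi] at hxi
  calc ‖(T ^ visitTime i) x - y p‖
      = ‖((T ^ visitTime i) x - (T ^ visitTime i) (z i))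
          + ((T ^ visitTime i) (z i) - y p)‖ := by congr 1; abel
    _ ≤ ρ ^ (Nat.pair p V + 1) * (2 * (1 - ρ)⁻¹) + ε p := norm_add_le_of_le hxi hnear
    _ < r := by linarith

end Criterion

section Cycles

variable {E : Type*} [NormedAddCommGroup E] [NormedSpace ℂ E]
  {T : E →L[ℂ] E} {u : ℕ → E} {D h φ : ℕ → ℕ} {v : ℕ → ℂ}

lemma pow_mul_apply_of_eigen {x : E} {p q : ℕ} (hx : (T ^ p) x = (1 / 2 : ℂ) ^ q • x) (a : ℕ) :
    (T ^ (p * a)) x = (1 / 2 : ℂ) ^ (q * a) • x := by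
  induction a with
  | zero => simp
  | succ a ih =>
    rw [Nat.mul_succ, add_comm, pow_add_apply, ih, map_smul, hx, smul_smul, ← pow_add,
      Nat.mul_succ]

lemma pow_two_mul_apply_of_cycle (hv0 : v 0 = 0)
    (hcyc : ∀ n, (T ^ D n) (u n) = (1 / 2 : ℂ) ^ h n • (v n • u (φ n) - u n))
    (hφ : ∀ n, 1 ≤ n → φ n < n ∧ ∃ c, D n = 2 * D (φ n) * c ∧ h n = 2 * h (φ n) * c) (n : ℕ) :
    (T ^ (2 * D n)) (u n) = (1 / 2 : ℂ) ^ (2 * h n) • u n := by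
  induction n using Nat.strong_induction_on with
  | _ n ih =>
    have hmul : v n • (T ^ D n) (u (φ n)) = v n • (1 / 2 : ℂ) ^ h n • u (φ n) := by
      rcases Nat.eq_zero_or_pos n with rfl | hn
      · simp [hv0]
      · obtain ⟨hlt, c, hc, hc'⟩ := hφ n hn
        rw [hc, hc', pow_mul_apply_of_eigen (ih _ hlt)]
    rw [two_mul, pow_add_apply, hcyc, map_smul, map_sub, map_smul, hmul, hcyc, two_mul, pow_add]
    module

lemma norm_pow_apply_le_of_cycle {ρ : ℝ} (h0 : 0 < ρ) (hv0 : v 0 = 0)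
    (hv : ∀ n, ‖v n‖ ≤ 1 / 2)
    (hcyc : ∀ n, (T ^ D n) (u n) = (1 / 2 : ℂ) ^ h n • (v n • u (φ n) - u n))
    (hφ : ∀ n, 1 ≤ n → φ n < n ∧ ∃ c, D n = 2 * D (φ n) * c ∧ h n = 2 * h (φ n) * c)
    (hD : ∀ n, 0 < D n) (hρ : ∀ n, ρ ^ D n = (1 / 2) ^ h n)
    (hhead : ∀ n, ∀ l < D n, ‖(T ^ l) (u n)‖ ≤ ρ ^ l) (n l : ℕ) :
    ‖(T ^ l) (u n)‖ ≤ 2 * ρ ^ l := by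
  have hhalf : ∀ n, ‖(1 / 2 : ℂ) ^ h n‖ = ρ ^ D n := fun n => by rw [hρ, norm_pow]; norm_num
  induction n using Nat.strong_induction_on generalizing l with
  | _ n ihn =>
    induction l using Nat.strong_induction_on with
    | _ l ihl =>
      rcases lt_or_ge l (D n) with hl | hl
      · linarith [hhead n l hl, pow_pos h0 l]
      obtain ⟨q, rfl⟩ := Nat.exists_eq_add_of_le' hl
      rcases lt_or_ge q (D n) with hq | hq
      · have hvq : ‖v n • (T ^ q) (u (φ n))‖ ≤ 1 / 2 * (2 * ρ ^ q) := by
          rcases Nat.eq_zero_or_pos n with rfl | hn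
          · rw [hv0, zero_smul, norm_zero]; positivity
          · rw [norm_smul]
            have := hv n
            have := ihn _ (hφ n hn).1 q
            gcongr
        rw [pow_add_apply, hcyc, map_smul, norm_smul, hhalf, map_sub, map_smul]
        calc ρ ^ D n * ‖v n • (T ^ q) (u (φ n)) - (T ^ q) (u n)‖
            ≤ ρ ^ D n * (1 / 2 * (2 * ρ ^ q) + ρ ^ q) := by
              gcongr
              exact (norm_sub_le _ _).trans (add_le_add hvq (hhead n q hq))
          _ = 2 * ρ ^ (q + D n) := by ring
      · obtain ⟨r, rfl⟩ := Nat.exists_eq_add_of_le' hq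
        rw [add_assoc, ← two_mul, pow_add_apply, pow_two_mul_apply_of_cycle hv0 hcyc hφ, map_smul,
          norm_smul, two_mul, pow_add, norm_mul, hhalf]
        calc ρ ^ D n * ρ ^ D n * ‖(T ^ r) (u n)‖ ≤ ρ ^ D n * ρ ^ D n * (2 * ρ ^ r) := by
              gcongr
              exact ihl r (by have := hD n; omega)
          _ = _ := by ring

lemma isTraceable_of_eigen {ρ : ℝ} (hρ0 : 1 / 2 ≤ ρ) (hρ1 : ρ ≤ 1) {m d q : ℕ} (hqd : q < d)
    (hperiod : (T ^ (2 * d)) (u m) = (1 / 2 : ℂ) ^ (2 * q) • u m)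
    (hbound : ∀ n l, ‖(T ^ l) (u n)‖ ≤ 2 * ρ ^ l) {c : ℂ} (hc : c ≠ 0)
    (hback : ∀ j s, ∃ N x, (∀ i ≤ s, ‖(T ^ i) x‖ ≤ (1 / 2) ^ (s - i)) ∧
      (T ^ (s + 1)) x = c • u m - u N ∧ ‖(T ^ j) (u N)‖ ≤ (1 / 2) ^ j) :
    IsTraceable T ρ (u m) := by
  have h0 : 0 < ρ := by linarith
  intro ε hε
  have hcpos : 0 < ‖c‖ := norm_pos_iff.2 hc
  obtain ⟨a, ha⟩ := exists_pow_lt_of_lt_one (mul_pos hcpos hε) (by norm_num : (1 / 2 : ℝ) < 1)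
  set j := 2 * d * a with hj
  set K : ℝ := ‖c‖⁻¹ * 2 ^ (2 * q * a) with hK
  have hKpos : 0 < K := by positivity
  refine ⟨K * (2 * ‖c‖ + 2) * (ρ ^ (j + 1))⁻¹, j + 1, fun n hn => ?_⟩
  obtain ⟨s, rfl⟩ := Nat.exists_eq_add_of_le' hn
  obtain ⟨N, x, hx, hxs, hN⟩ := hback j s
  have hsc : ‖c⁻¹ * (2 : ℂ) ^ (2 * q * a)‖ = K := by
    rw [norm_mul, norm_inv, norm_pow, Complex.norm_two]
  refine ⟨(c⁻¹ * 2 ^ (2 * q * a)) • x, fun i => ?_, ?_⟩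
  · rw [map_smul, norm_smul, hsc, mul_assoc (K * _), mul_assoc K]
    refine mul_le_mul_of_nonneg_left ?_ hKpos.le
    have key : ∀ p, (s + (j + 1) - i) + (i - (s + (j + 1))) ≤ p + (j + 1) →
        ρ ^ p ≤ (ρ ^ (j + 1))⁻¹ * ρ ^ ((s + (j + 1) - i) + (i - (s + (j + 1)))) := by
      intro p hp
      rw [le_inv_mul_iff₀ (by positivity), ← pow_add]
      exact pow_le_pow_of_le_one h0.le hρ1 (by omega)
    rcases le_or_gt i s with his | his
    · calc ‖(T ^ i) x‖ ≤ (1 / 2) ^ (s - i) := hx i his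
        _ ≤ ρ ^ (s - i) := by gcongr
        _ = 1 * ρ ^ (s - i) := (one_mul _).symm
        _ ≤ _ := by
          gcongr
          · linarith
          · exact key _ (by omega)
    · obtain ⟨p, rfl⟩ := Nat.exists_eq_add_of_le' (Nat.succ_le_of_lt his)
      rw [Nat.succ_eq_add_one, pow_add_apply, hxs, map_sub, map_smul]
      calc ‖c • (T ^ p) (u m) - (T ^ p) (u N)‖ ≤ ‖c‖ * (2 * ρ ^ p) + 2 * ρ ^ p := by
            refine (norm_sub_le _ _).trans ?_
            rw [norm_smul]
            gcongr
            exacts [hbound m p, hbound N p]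
        _ = (2 * ‖c‖ + 2) * ρ ^ p := by ring
        _ ≤ _ := by
          gcongr
          exact key _ (by omega)
  · have hcancel : c⁻¹ * 2 ^ (2 * q * a) * c * (1 / 2 : ℂ) ^ (2 * q * a) = 1 := by
      rw [mul_assoc, mul_mul_mul_comm, inv_mul_cancel₀ hc, ← mul_pow]
      norm_num
    have heq : (T ^ (s + (j + 1))) ((c⁻¹ * 2 ^ (2 * q * a)) • x) - u m
        = -((c⁻¹ * 2 ^ (2 * q * a)) • (T ^ j) (u N)) := by
      rw [show s + (j + 1) = j + (s + 1) by ring, map_smul, pow_add_apply, hxs, map_sub, map_smul,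
        hj, pow_mul_apply_of_eigen hperiod, smul_sub, smul_smul, smul_smul, hcancel, one_smul]
      abel
    rw [heq, norm_neg, norm_smul, hsc]
    calc K * ‖(T ^ j) (u N)‖ ≤ K * (1 / 2) ^ (2 * q * a + a) := by
          gcongr
          refine hN.trans (pow_le_pow_of_le_one (by norm_num) (by norm_num) ?_)
          rw [hj]
          nlinarith
      _ = ‖c‖⁻¹ * (1 / 2) ^ a * (2 * (1 / 2)) ^ (2 * q * a) := by rw [hK, mul_pow]; ring
      _ = ‖c‖⁻¹ * (1 / 2) ^ a := by norm_num
      _ ≤ ‖c‖⁻¹ * (‖c‖ * ε) := by gcongr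
      _ = ε := by field_simp

end Cycles

section Blocks

lemma norm_e (k : ℕ) : ‖e k‖ = 1 := by
  simp [e, lp.norm_single]

lemma mem_closure_span_range_e (x : X) :
    x ∈ closure (Submodule.span ℂ (Set.range e) : Set X) := by
  refine mem_closure_of_tendsto (lp.hasSum_single (by simp) x)
    (Filter.Eventually.of_forall fun s => Submodule.sum_mem _ fun i _ => ?_)
  have h : lp.single 1 i (x i) = x i • e i := by
    rw [e, ← lp.single_smul, smul_eq_mul, mul_one]
  rw [h]
  exact Submodule.smul_mem _ _ (Submodule.subset_span ⟨i, rfl⟩)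

instance : TopologicalSpace.SeparableSpace X := by
  rw [← TopologicalSpace.isSeparable_univ_iff]
  refine TopologicalSpace.IsSeparable.mono
    ((Set.countable_range e).isSeparable.span (R := ℂ)).closure fun x _ => ?_
  exact mem_closure_span_range_e x

/-- Minus the binary logarithm of the product of the first `l` weights of a block of length `D`
with parameters `d` and `h`. -/
def weightExponent (D d h l : ℕ) : ℕ :=
  if l ≤ h then l
  else if l + 1 ≤ D - 2 * d then h
  else if l + 1 ≤ D - d then h + (l + 1 - (D - 2 * d))
  else h + (D - 1 - l)

variable {T : X →L[ℂ] X} {w : ℕ → ℂ} {β D d h : ℕ}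

lemma pow_apply_e_start (hcomb : 2 * d + h < D)
    (hw : ∀ i, β < i → i < β + D → w i = if i ≤ β + h then (1 / 2 : ℂ)
      else if i < β + D - 2 * d then 1 else if i < β + D - d then (1 / 2 : ℂ) else 2)
    (hT : ∀ k, β ≤ k → k + 1 < β + D → T (e k) = w (k + 1) • e (k + 1)) (l : ℕ) (hl : l < D) :
    (T ^ l) (e β) = (1 / 2 : ℂ) ^ weightExponent D d h l • e (β + l) := by
  induction l with
  | zero =>
    have : weightExponent D d h 0 = 0 := by unfold weightExponent; split_ifs <;> omega
    simp [this]
  | succ l ih =>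
    rw [add_comm l 1, pow_add_apply, ih (by omega), pow_one, map_smul,
      hT _ (by omega) (by omega), hw _ (by omega) (by omega), smul_smul, add_comm 1 l]
    congr 1
    split_ifs with h1 h2 h3
    · rw [← pow_succ]; congr 1; unfold weightExponent; split_ifs <;> omega
    · rw [mul_one]; congr 1; unfold weightExponent; split_ifs <;> omega
    · rw [← pow_succ]; congr 1; unfold weightExponent; split_ifs <;> omega
    · have : weightExponent D d h l = weightExponent D d h (l + 1) + 1 := by
        unfold weightExponent; split_ifs <;> omega
      rw [this, pow_succ]
      ring

lemma pow_apply_e_end (hcomb : 2 * d + h < D)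
    (hw : ∀ i, β < i → i < β + D → w i = if i ≤ β + h then (1 / 2 : ℂ)
      else if i < β + D - 2 * d then 1 else if i < β + D - d then (1 / 2 : ℂ) else 2)
    (hT : ∀ k, β ≤ k → k + 1 < β + D → T (e k) = w (k + 1) • e (k + 1))
    {s : ℕ} (hs : s ≤ d) (i : ℕ) (hi : i ≤ s) :
    (T ^ i) (e (β + D - 1 - s)) = (2 : ℂ) ^ i • e (β + D - 1 - s + i) := by
  induction i with
  | zero => simp
  | succ i ih =>
    rw [add_comm i 1, pow_add_apply, ih (by omega), pow_one, map_smul, hT _ (by omega) (by omega),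
      hw _ (by omega) (by omega), if_neg (by omega), if_neg (by omega), if_neg (by omega), smul_smul,
      add_comm 1 i, pow_succ, add_assoc]

lemma norm_half_pow (n : ℕ) : ‖(1 / 2 : ℂ) ^ n‖ = (1 / 2) ^ n := by
  rw [norm_pow]; norm_num

lemma pow_length_apply_e_start (hd : 0 < d) (hcomb : 2 * d + h < D)
    (hw : ∀ i, β < i → i < β + D → w i = if i ≤ β + h then (1 / 2 : ℂ)
      else if i < β + D - 2 * d then 1 else if i < β + D - d then (1 / 2 : ℂ) else 2)
    (hT : ∀ k, β ≤ k → k + 1 < β + D → T (e k) = w (k + 1) • e (k + 1)) :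
    (T ^ D) (e β) = (1 / 2 : ℂ) ^ h • T (e (β + D - 1)) := by
  obtain ⟨D, rfl⟩ : ∃ D', D = 1 + D' := ⟨D - 1, by omega⟩
  have hexp : weightExponent (1 + D) d h D = h := by
    unfold weightExponent; split_ifs <;> omega
  rw [pow_add_apply, pow_apply_e_start hcomb hw hT D (by omega), hexp, pow_one, map_smul,
    show β + (1 + D) - 1 = β + D by omega]

lemma norm_pow_apply_e_start_of_le (hcomb : 2 * d + h < D)
    (hw : ∀ i, β < i → i < β + D → w i = if i ≤ β + h then (1 / 2 : ℂ)
      else if i < β + D - 2 * d then 1 else if i < β + D - d then (1 / 2 : ℂ) else 2)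
    (hT : ∀ k, β ≤ k → k + 1 < β + D → T (e k) = w (k + 1) • e (k + 1))
    {l : ℕ} (hl : l ≤ h) : ‖(T ^ l) (e β)‖ = (1 / 2) ^ l := by
  rw [pow_apply_e_start hcomb hw hT l (by omega), norm_smul, norm_e, mul_one, norm_half_pow,
    weightExponent, if_pos hl]

lemma norm_pow_apply_e_start_le (hcomb : 2 * d + h < D)
    (hw : ∀ i, β < i → i < β + D → w i = if i ≤ β + h then (1 / 2 : ℂ)
      else if i < β + D - 2 * d then 1 else if i < β + D - d then (1 / 2 : ℂ) else 2)
    (hT : ∀ k, β ≤ k → k + 1 < β + D → T (e k) = w (k + 1) • e (k + 1))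
    {ρ : ℝ} (hρ0 : 1 / 2 ≤ ρ) (hρ1 : ρ ≤ 1) (hρ : ρ ^ D = (1 / 2) ^ h) {l : ℕ} (hl : l < D) :
    ‖(T ^ l) (e β)‖ ≤ ρ ^ l := by
  rcases le_or_gt l h with hle | hlt
  · rw [norm_pow_apply_e_start_of_le hcomb hw hT hle]
    gcongr
  · have hexp : h ≤ weightExponent D d h l := by
      unfold weightExponent; split_ifs <;> omega
    rw [pow_apply_e_start hcomb hw hT l hl, norm_smul, norm_e, mul_one, norm_half_pow]
    calc (1 / 2 : ℝ) ^ weightExponent D d h l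
        ≤ (1 / 2) ^ h := pow_le_pow_of_le_one (by norm_num) (by norm_num) hexp
      _ = ρ ^ D := hρ.symm
      _ ≤ ρ ^ l := pow_le_pow_of_le_one (by linarith) hρ1 hl.le

lemma exists_small_preimage_block_end (hcomb : 2 * d + h < D)
    (hw : ∀ i, β < i → i < β + D → w i = if i ≤ β + h then (1 / 2 : ℂ)
      else if i < β + D - 2 * d then 1 else if i < β + D - d then (1 / 2 : ℂ) else 2)
    (hT : ∀ k, β ≤ k → k + 1 < β + D → T (e k) = w (k + 1) • e (k + 1))
    {s : ℕ} (hs : s ≤ d) :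
    ∃ x, (∀ i ≤ s, ‖(T ^ i) x‖ ≤ (1 / 2) ^ (s - i)) ∧ (T ^ (s + 1)) x = T (e (β + D - 1)) := by
  have horb := pow_apply_e_end hcomb hw hT hs
  refine ⟨(1 / 2 : ℂ) ^ s • e (β + D - 1 - s), fun i hi => le_of_eq ?_, ?_⟩
  · rw [map_smul, horb i hi, norm_smul, norm_smul, norm_e, mul_one, norm_half_pow, norm_pow,
      Complex.norm_two]
    obtain ⟨r, rfl⟩ := Nat.exists_eq_add_of_le' hi
    rw [Nat.add_sub_cancel, pow_add, mul_assoc, ← mul_pow]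
    norm_num
  · rw [add_comm s 1, map_smul, pow_add_apply, horb s le_rfl, pow_one, map_smul,
      Nat.sub_add_cancel (by omega), smul_smul, ← mul_pow]
    norm_num

lemma isTraceable_of_mem_block (hcomb : 2 * d + h < D)
    (hw : ∀ i, β < i → i < β + D → w i = if i ≤ β + h then (1 / 2 : ℂ)
      else if i < β + D - 2 * d then 1 else if i < β + D - d then (1 / 2 : ℂ) else 2)
    (hT : ∀ k, β ≤ k → k + 1 < β + D → T (e k) = w (k + 1) • e (k + 1))
    {ρ : ℝ} (hβ : IsTraceable T ρ (e β)) {k : ℕ} (hk : β ≤ k) (hk' : k < β + D) :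
    IsTraceable T ρ (e k) := by
  have horb := pow_apply_e_start hcomb hw hT (k - β) (by omega)
  rw [Nat.add_sub_cancel' hk] at horb
  have hek : e k = ((1 / 2 : ℂ) ^ weightExponent D d h (k - β))⁻¹ • (T ^ (k - β)) (e β) := by
    rw [horb, inv_smul_smul₀ (pow_ne_zero _ (by norm_num))]
  rw [hek]
  exact (hβ.map _ ((Commute.refl T).pow_right _)).smul _

end Blocks

section Levels

lemma two_pow_pred_size_le {n : ℕ} (hn : 1 ≤ n) : 2 ^ (n.size - 1) ≤ n :=
  Nat.lt_size.1 (by have := Nat.size_pos.2 hn; omega)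

lemma size_sub_two_pow_lt {n : ℕ} (hn : 1 ≤ n) : (n - 2 ^ (n.size - 1)).size < n.size := by
  have h1 := Nat.size_pos.2 hn
  have h2 : 2 ^ n.size = 2 * 2 ^ (n.size - 1) := by rw [← pow_succ', Nat.sub_add_cancel h1]
  have h3 : n < 2 ^ n.size := Nat.lt_size_self n
  have h4 : (n - 2 ^ (n.size - 1)).size ≤ n.size - 1 := Nat.size_le.2 (by omega)
  omega

lemma size_two_pow_add {k m : ℕ} (hm : m < 2 ^ k) : (2 ^ k + m).size = k + 1 :=
  le_antisymm (Nat.size_le.2 (by rw [pow_succ]; omega)) (Nat.lt_size.2 (by omega))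

lemma two_mul_dvd_of_lt {Δ : ℕ → ℕ} (hdvd : ∀ k, 2 * Δ k ∣ Δ (k + 1)) {j k : ℕ} (h : j < k) :
    2 * Δ j ∣ Δ k := by
  induction k, h using Nat.le_induction with
  | base => exact hdvd j
  | succ k _ ih => exact ih.trans ((Dvd.intro_left 2 rfl).trans (hdvd k))

lemma exists_mem_block {b : ℕ → ℕ} (hb0 : b 0 = 0) (hb : StrictMono b) (k : ℕ) :
    ∃ n, b n ≤ k ∧ k < b (n + 1) := by
  induction k with
  | zero => exact ⟨0, hb0.le, by have := hb Nat.zero_lt_one; simp only [zero_add]; omega⟩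
  | succ k ih =>
    obtain ⟨n, h1, h2⟩ := ih
    rcases lt_or_ge (k + 1) (b (n + 1)) with h | h
    · exact ⟨n, by omega, h⟩
    · exact ⟨n + 1, h, by have := hb (Nat.lt_add_one (n + 1)); omega⟩

lemma exists_rate {η Δ : ℕ → ℕ} (hη : 0 < η 0) (hΔ : ∀ k, 0 < Δ k) (hlt : η 0 < Δ 0)
    (hratio : ∀ k, (η k : ℝ) / (Δ k : ℝ) = (η 0 : ℝ) / (Δ 0 : ℝ)) :
    ∃ ρ : ℝ, 1 / 2 ≤ ρ ∧ ρ < 1 ∧ ∀ k, ρ ^ Δ k = (1 / 2) ^ η k := by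
  have hΔ0 : (0 : ℝ) < Δ 0 := by exact_mod_cast hΔ 0
  have hη0 : (0 : ℝ) < η 0 := by exact_mod_cast hη
  refine ⟨(1 / 2 : ℝ) ^ ((η 0 : ℝ) / Δ 0), ?_, ?_, fun k => ?_⟩
  · have h1 : (η 0 : ℝ) / Δ 0 ≤ 1 := by
      rw [div_le_one hΔ0]; exact_mod_cast hlt.le
    simpa using Real.rpow_le_rpow_of_exponent_ge (by norm_num : (0 : ℝ) < 1 / 2) (by norm_num) h1
  · exact Real.rpow_lt_one (by norm_num) (by norm_num) (by positivity)
  · have hΔk : (Δ k : ℝ) ≠ 0 := by exact_mod_cast (hΔ k).ne'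
    rw [← Real.rpow_natCast, ← Real.rpow_mul (by norm_num), ← hratio k, div_mul_cancel₀ _ hΔk,
      Real.rpow_natCast]

end Levels

/-- Proposition 3.3: `T̃` is a frequently hypercyclic operator on `ℓ¹(ℕ)`. -/
theorem frequentlyHypercyclic_T
    -- the parameters `(τ_m)`, `(δ^{(k)})`, `(η^{(k)})`, `(Δ^{(k)})`:
    -- increasing sequences of positive integers
    (τ δ η Δ : ℕ → ℕ)
    (hτ : StrictMono τ) (hτpos : ∀ m, 0 < τ m)
    (hδ : StrictMono δ) (hδpos : ∀ k, 0 < δ k)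
    (hη : StrictMono η) (hηpos : ∀ k, 0 < η k)
    (hΔ : StrictMono Δ) (hΔpos : ∀ k, 0 < Δ k)
    (hcomb : ∀ k, 2 * δ k + η k < Δ k)
    (hdvd : ∀ k, 2 * Δ k ∣ Δ (k + 1))
    (hratio : ∀ k, (η k : ℝ) / (Δ k : ℝ) = (η 0 : ℝ) / (Δ 0 : ℝ))
    -- `n_0 = 0` and `n_k = 2^{k-1}` for `k ≥ 1`
    (nseq : ℕ → ℕ) (hn0 : nseq 0 = 0) (hnk : ∀ k, 1 ≤ k → nseq k = 2 ^ (k - 1))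
    -- `φ(n) = n - n_k` for `n ∈ [n_k, n_{k+1})`
    (φ : ℕ → ℕ) (hφ : ∀ k n, nseq k ≤ n → n < nseq (k + 1) → φ n = n - nseq k)
    -- `v_n = 2^{-τ_{φ(n)}}` for `n ≥ 1`
    (v : ℕ → ℂ) (hv : ∀ n, 1 ≤ n → v n = (2 : ℂ) ^ (-(τ (φ n) : ℤ)))
    -- `b_0 = 0` and `b_{n+1} - b_n = Δ^{(k)}` for `n ∈ [n_k, n_{k+1})`
    (b : ℕ → ℕ) (hb0 : b 0 = 0)
    (hb : ∀ k n, nseq k ≤ n → n < nseq (k + 1) → b (n + 1) = b n + Δ k)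
    -- the weights `(w_i)`
    (w : ℕ → ℂ)
    (hw : ∀ k n, nseq k ≤ n → n < nseq (k + 1) → ∀ i, b n < i → i < b (n + 1) →
      w i = if i ≤ b n + η k then (1 / 2 : ℂ)
        else if i < b (n + 1) - 2 * δ k then 1
        else if i < b (n + 1) - δ k then (1 / 2 : ℂ)
        else 2)
    -- the defining equations of the operator `T̃`
    (T : X →L[ℂ] X)
    (hT1 : ∀ n k, b n ≤ k → k + 1 < b (n + 1) → T (e k) = w (k + 1) • e (k + 1))
    (hT2 : ∀ n, 1 ≤ n → T (e (b (n + 1) - 1)) = v n • e (b (φ n)) - e (b n))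
    (hT3 : T (e (b 1 - 1)) = -(e 0))
    : FrequentlyHypercyclic T := by
  have hnseq : ∀ k, nseq (k + 1) = 2 ^ k := fun k => by rw [hnk _ (by omega), Nat.add_sub_cancel]
  have hsize : ∀ n, 1 ≤ n → nseq n.size = 2 ^ (n.size - 1) := fun n hn =>
    hnk _ (Nat.size_pos.2 hn)
  have hlevel : ∀ n, nseq n.size ≤ n ∧ n < nseq (n.size + 1) := by
    intro n
    refine ⟨?_, by rw [hnseq]; exact Nat.lt_size_self n⟩
    rcases Nat.eq_zero_or_pos n with rfl | hn
    · simp [hn0]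
    · rw [hsize n hn]; exact two_pow_pred_size_le hn
  have hbD : ∀ n, b (n + 1) = b n + Δ n.size := fun n => hb _ n (hlevel n).1 (hlevel n).2
  have hφn : ∀ n, 1 ≤ n → φ n = n - 2 ^ (n.size - 1) := fun n hn => by
    rw [hφ _ n (hlevel n).1 (hlevel n).2, hsize n hn]
  have hwD := fun n => hbD n ▸ hw n.size n (hlevel n).1 (hlevel n).2
  have hTD : ∀ n k, b n ≤ k → k + 1 < b n + Δ n.size → T (e k) = w (k + 1) • e (k + 1) :=
    fun n k h1 h2 => hT1 n k h1 (by rwa [hbD])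
  obtain ⟨ρ, hρhalf, hρ1, hρ⟩ := exists_rate (hηpos 0) hΔpos (by have := hcomb 0; omega) hratio
  have hρ0 : 0 < ρ := by linarith
  set v' : ℕ → ℂ := fun n => if n = 0 then 0 else v n with hv'
  have hv'_norm : ∀ n, ‖v' n‖ ≤ 1 / 2 := by
    intro n
    rcases Nat.eq_zero_or_pos n with rfl | hn
    · simp [hv']
    · rw [hv']
      simp only [hn.ne', if_false]
      rw [hv n hn, zpow_neg, zpow_natCast, norm_inv, norm_pow, Complex.norm_two, ← inv_pow,
        one_div]
      exact pow_le_of_le_one (by norm_num) (by norm_num) (hτpos _).ne'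
  have hend : ∀ n, T (e (b n + Δ n.size - 1)) = v' n • e (b (φ n)) - e (b n) := by
    intro n
    rw [← hbD]
    rcases Nat.eq_zero_or_pos n with rfl | hn
    · simpa [hv', hb0] using hT3
    · simpa [hv', hn.ne'] using hT2 n hn
  have hcyc : ∀ n, (T ^ Δ n.size) (e (b n))
      = (1 / 2 : ℂ) ^ η n.size • (v' n • e (b (φ n)) - e (b n)) := fun n => by
    rw [pow_length_apply_e_start (hδpos _) (hcomb _) (hwD n) (hTD n), hend]
  have hdesc : ∀ n, 1 ≤ n → φ n < n ∧ ∃ c, Δ n.size = 2 * Δ (φ n).size * c ∧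
      η n.size = 2 * η (φ n).size * c := by
    intro n hn
    rw [hφn n hn]
    refine ⟨Nat.sub_lt hn (by positivity), ?_⟩
    obtain ⟨c, hc⟩ := two_mul_dvd_of_lt hdvd (size_sub_two_pow_lt hn)
    refine ⟨c, hc, ?_⟩
    set j := (n - 2 ^ (n.size - 1)).size
    have hj : (Δ j : ℝ) ≠ 0 := by exact_mod_cast (hΔpos j).ne'
    have hn' : (Δ n.size : ℝ) ≠ 0 := by exact_mod_cast (hΔpos n.size).ne'
    have hr := (hratio n.size).trans (hratio j).symm
    rw [div_eq_div_iff hn' hj] at hr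
    have hr' : η n.size * Δ j = η j * Δ n.size := by exact_mod_cast hr
    refine Nat.eq_of_mul_eq_mul_right (hΔpos j) ?_
    rw [hr', hc]
    ring
  have hhead : ∀ n, ∀ l < Δ n.size, ‖(T ^ l) (e (b n))‖ ≤ ρ ^ l := fun n l hl =>
    norm_pow_apply_e_start_le (hcomb _) (hwD n) (hTD n) hρhalf hρ1.le (hρ _) hl
  have hv'0 : v' 0 = 0 := if_pos rfl
  have hperiod := pow_two_mul_apply_of_cycle (u := fun n => e (b n)) (D := fun n => Δ n.size)
    (h := fun n => η n.size) hv'0 hcyc hdesc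
  have hbound := norm_pow_apply_le_of_cycle (u := fun n => e (b n)) (D := fun n => Δ n.size)
    (h := fun n => η n.size) hρ0 hv'0 hv'_norm hcyc hdesc (fun n => hΔpos _) (fun n => hρ _) hhead
  have hback : ∀ m j s, ∃ N x, (∀ i ≤ s, ‖(T ^ i) x‖ ≤ (1 / 2) ^ (s - i)) ∧
      (T ^ (s + 1)) x = (2 : ℂ) ^ (-(τ m : ℤ)) • e (b m) - e (b N) ∧
      ‖(T ^ j) (e (b N))‖ ≤ (1 / 2) ^ j := by
    intro m j s
    set k := m + j + s with hk
    have hm : m < 2 ^ k := m.lt_two_pow_self.trans_le (Nat.pow_le_pow_right two_pos (by omega))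
    have hNsize := size_two_pow_add hm
    set N := 2 ^ k + m with hN
    have hN1 : 1 ≤ N := by have := k.one_le_two_pow; omega
    have hφN : φ N = m := by rw [hφn N hN1, hNsize, Nat.add_sub_cancel, hN, Nat.add_sub_cancel_left]
    have hsδ : s ≤ δ N.size := le_trans (by omega) hδ.le_apply
    have hjη : j ≤ η N.size := le_trans (by omega) hη.le_apply
    obtain ⟨x, hx, hxs⟩ := exists_small_preimage_block_end (hcomb _) (hwD N) (hTD N) hsδ
    refine ⟨N, x, hx, ?_, (norm_pow_apply_e_start_of_le (hcomb _) (hwD N) (hTD N) hjη).le⟩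
    rw [hxs, hend, hφN, show v' N = v N from if_neg (by omega), hv N hN1, hφN]
  have hstart : ∀ m, IsTraceable T ρ (e (b m)) := fun m =>
    isTraceable_of_eigen (u := fun n => e (b n)) hρhalf hρ1.le
      (by have := hcomb m.size; omega) (hperiod m) hbound (zpow_ne_zero _ two_ne_zero) (hback m)
  have hbasis : ∀ k, IsTraceable T ρ (e k) := by
    have hbmono : StrictMono b := strictMono_nat_of_lt_succ fun n => by
      have := hΔpos n.size
      rw [hbD]; omega
    intro k
    obtain ⟨n, hn1, hn2⟩ := exists_mem_block hb0 hbmono k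
    exact isTraceable_of_mem_block (hcomb _) (hwD n) (hTD n) (hstart n) hn1 (hbD n ▸ hn2)
  have hall : ∀ y, IsTraceable T ρ y := fun y =>
    IsTraceable.of_mem_closure_span (by rintro _ ⟨k, rfl⟩; exact hbasis k)
      (mem_closure_span_range_e y)
  obtain ⟨x, hx⟩ := exists_visits_every_open hρ0 hρ1 hall
  refine ⟨x, fun U hU hne => ?_⟩
  obtain ⟨l, hl⟩ := hx U hU hne
  exact liminf_card_div_pos (A := {n | (T ^ n) x ∈ U}) (by positivity) (card_visits_ge hl)
end
end
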